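/- Let n ∈ ℕ and L, C, R ∈ ℝ_max^{n×n}, and consider the lifted system with matrices Ā, B̄, H and semimodule K = Im H*. For every k ∈ ℕ₀, φ^k(K) equals the set of pairs (x₁, x₂) ∈ ℝ_max^{2n} for which there exist x₃, …, x_{k+2} ∈ ℝ_max^n such that the stacked vector (x₁, x₂, …, x_{k+2}) ∈ ℝ_max^{(k+2)n} satisfies (x₁,…,x_{k+2}) ≥ M_[k+2] ⊗ (x₁,…,x_{k+2}). -/

import Mathlib

noncomputable section

open scoped Classical

/-- Max-plus matrix-vector product: `(A ⊗ x)_i = sup_j (A_{ij} + x_j)`. -/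
def mpMulVec {N P : Type*} (A : N → P → EReal) (x : P → EReal) : N → EReal :=
  fun i => ⨆ j, A i j + x j

/-- Max-plus matrix-matrix product. -/
def mpMulMat {N P Q : Type*} (A : N → P → EReal) (B : P → Q → EReal) : N → Q → EReal :=
  fun i j => ⨆ k, A i k + B k j

/-- Max-plus identity matrix `E`. -/
def mpId {N : Type*} [DecidableEq N] : N → N → EReal :=
  fun i j => if i = j then (0 : EReal) else ⊥

/-- Max-plus matrix powers: `A^0 = E`, `A^{k+1} = A^k ⊗ A`. -/
def mpPow {N : Type*} [DecidableEq N] (A : N → N → EReal) : ℕ → N → N → EReal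
  | 0 => mpId
  | k + 1 => mpMulMat (mpPow A k) A

/-- Kleene star `A* = sup_{k ≥ 0} A^k` (entrywise supremum). -/
def mpStar {N : Type*} [DecidableEq N] (A : N → N → EReal) : N → N → EReal :=
  fun i j => ⨆ k : ℕ, mpPow A k i j

/-- Image of a matrix: `Im U = { U ⊗ u : u ∈ ℝ_max^P } ⊆ ℝ_max^N`. -/
def mpIm {N P : Type*} (U : N → P → EReal) : Set (N → EReal) :=
  { x | (∀ i, x i ≠ ⊤) ∧ ∃ u : P → EReal, (∀ j, u j ≠ ⊤) ∧ x = mpMulVec U u }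

/-- Existence of a positive-weight circuit in the precedence graph `G(A)`. -/
def hasPosCircuit {N : Type*} (A : N → N → EReal) : Prop :=
  ∃ (l : ℕ) (p : ℕ → N), p l = p 0 ∧ (∀ t < l, A (p (t + 1)) (p t) ≠ ⊥) ∧
    0 < ∑ t ∈ Finset.range l, A (p (t + 1)) (p t)

/-- The block-tridiagonal matrix `M_[K]` with diagonal blocks `C`,
superdiagonal blocks `L`, subdiagonal blocks `R`. -/
def MK {n : ℕ} (L C R : Fin n → Fin n → EReal) (K : ℕ) :
    Fin K × Fin n → Fin K × Fin n → EReal :=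
  fun p q =>
    if p.1.val = q.1.val then C p.2 q.2
    else if p.1.val + 1 = q.1.val then L p.2 q.2
    else if q.1.val + 1 = p.1.val then R p.2 q.2
    else ⊥

/-- The infinite block-tridiagonal matrix `M_[∞]`, indexed by `ℕ × Fin n`. -/
def Minf {n : ℕ} (L C R : Fin n → Fin n → EReal) :
    ℕ × Fin n → ℕ × Fin n → EReal :=
  fun p q =>
    if p.1 = q.1 then C p.2 q.2
    else if p.1 + 1 = q.1 then L p.2 q.2
    else if q.1 + 1 = p.1 then R p.2 q.2
    else ⊥

/-- Existence of a finite real trajectory `x : {1,…,K} → ℝ^n` satisfying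
`x(k) ≥ C ⊗ x(k)`, `x(k) ≥ L ⊗ x(k+1)` and `x(k+1) ≥ R ⊗ x(k)`. -/
def FiniteTraj {n : ℕ} (L C R : Fin n → Fin n → EReal) (K : ℕ) : Prop :=
  ∃ x : Fin K → Fin n → ℝ,
    (∀ k : Fin K, ∀ i, mpMulVec C (fun j => (x k j : EReal)) i ≤ (x k i : EReal)) ∧
    (∀ k : Fin K, ∀ h : k.val + 1 < K, ∀ i,
      mpMulVec L (fun j => (x ⟨k.val + 1, h⟩ j : EReal)) i ≤ (x k i : EReal) ∧
      mpMulVec R (fun j => (x k j : EReal)) i ≤ (x ⟨k.val + 1, h⟩ i : EReal))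

/-- Weak consistency of system (8). -/
def WeaklyConsistent {n : ℕ} (L C R : Fin n → Fin n → EReal) : Prop :=
  ∀ K : ℕ, FiniteTraj L C R K

/-- Consistency of system (8): existence of an infinite real trajectory. -/
def Consistent {n : ℕ} (L C R : Fin n → Fin n → EReal) : Prop :=
  ∃ x : ℕ → Fin n → ℝ, ∀ k : ℕ,
    (∀ i, mpMulVec L (fun j => (x (k + 1) j : EReal)) i ≤ (x k i : EReal)) ∧
    (∀ i, mpMulVec C (fun j => (x k j : EReal)) i ≤ (x k i : EReal)) ∧
    (∀ i, mpMulVec R (fun j => (x k j : EReal)) i ≤ (x (k + 1) i : EReal))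

/-- The sequence `Π_0 = C*`, `Π_{k+1} = (L ⊗ Π_k ⊗ R ⊕ C)*`. -/
def PiSeq {n : ℕ} (L C R : Fin n → Fin n → EReal) : ℕ → Fin n → Fin n → EReal
  | 0 => mpStar C
  | k + 1 => mpStar (fun i j => max (mpMulMat (mpMulMat L (PiSeq L C R k)) R i j) (C i j))

/-- Lifted matrix `Ā = [[ε, E], [ε, ε]]`. -/
def Abar (n : ℕ) : Fin n ⊕ Fin n → Fin n ⊕ Fin n → EReal :=
  fun p q =>
    match p, q with
    | Sum.inl i, Sum.inr j => mpId i j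
    | _, _ => ⊥

/-- Lifted matrix `B̄ = [ε; E]`. -/
def Bbar (n : ℕ) : Fin n ⊕ Fin n → Fin n → EReal :=
  fun p j =>
    match p with
    | Sum.inl _ => ⊥
    | Sum.inr i => mpId i j

/-- Lifted matrix `H = [[C, L], [R, C]]`. -/
def Hmat {n : ℕ} (L C R : Fin n → Fin n → EReal) :
    Fin n ⊕ Fin n → Fin n ⊕ Fin n → EReal :=
  fun p q =>
    match p, q with
    | Sum.inl i, Sum.inl j => C i j
    | Sum.inl i, Sum.inr j => L i j
    | Sum.inr i, Sum.inl j => R i j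
    | Sum.inr i, Sum.inr j => C i j

/-- The semimodule `K = Im H*`. -/
def Kset {n : ℕ} (L C R : Fin n → Fin n → EReal) : Set (Fin n ⊕ Fin n → EReal) :=
  mpIm (mpStar (Hmat L C R))

/-- The map `φ(X) = X ∩ { x ∈ ℝ_max^N : ∃ u ∈ ℝ_max^M, A ⊗ x ⊕ B ⊗ u ∈ X }`. -/
def mpPhi {N M : Type*} (A : N → N → EReal) (B : N → M → EReal)
    (X : Set (N → EReal)) : Set (N → EReal) :=
  X ∩ { x | (∀ i, x i ≠ ⊤) ∧ ∃ u : M → EReal, (∀ j, u j ≠ ⊤) ∧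
    (fun i => max (mpMulVec A x i) (mpMulVec B u i)) ∈ X }

/-- Controlled trajectory: `x(1) = x0`, `x(k+1) = A ⊗ x(k) ⊕ B ⊗ u(k)`. -/
def mpTraj {N M : Type*} (A : N → N → EReal) (B : N → M → EReal)
    (x0 : N → EReal) (u : ℕ → M → EReal) : ℕ → N → EReal
  | 0 => x0
  | k + 1 => fun i => max (mpMulVec A (mpTraj A B x0 u k) i) (mpMulVec B (u k) i)

/-- `K^♯`: states of `K` from which some control keeps the whole trajectory in `K`. -/
def mpKsharp {N M : Type*} (A : N → N → EReal) (B : N → M → EReal)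
    (K : Set (N → EReal)) : Set (N → EReal) :=
  { x | x ∈ K ∧ ∃ u : ℕ → M → EReal, (∀ k j, u k j ≠ ⊤) ∧
    ∀ k : ℕ, mpTraj A B x u k ∈ K }

/-- Real vectors `ℝ^N` inside `ℝ̄^N`. -/
def RealVecs {N : Type*} : Set (N → EReal) := { x | ∀ i, x i ≠ ⊤ ∧ x i ≠ ⊥ }

/-- Semimodules of `ℝ_max^N`: closed under entrywise max and scalar addition. -/
def IsSemimodule {N : Type*} (X : Set (N → EReal)) : Prop :=
  (∀ x ∈ X, ∀ i, x i ≠ ⊤) ∧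
  (∀ x ∈ X, ∀ y ∈ X, (fun i => max (x i) (y i)) ∈ X) ∧
  (∀ x ∈ X, ∀ lam : EReal, lam ≠ ⊤ → (fun i => lam + x i) ∈ X)

/-- Embedding of the first two block indices into `Fin (k+2) × Fin n`. -/
def emb2 {n : ℕ} (k : ℕ) : Fin n ⊕ Fin n → Fin (k + 2) × Fin n
  | Sum.inl i => (⟨0, by omega⟩, i)
  | Sum.inr i => (⟨1, by omega⟩, i)

/-- `S_{k+2}`: top-left `2n × 2n` submatrix of `(M_[k+2])*`. -/
def Smat {n : ℕ} (L C R : Fin n → Fin n → EReal) (k : ℕ) :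
    Fin n ⊕ Fin n → Fin n ⊕ Fin n → EReal :=
  fun p q => mpStar (MK L C R (k + 2)) (emb2 k p) (emb2 k q)

/-- Embedding of the first two block indices into `ℕ × Fin n`. -/
def embInf {n : ℕ} : Fin n ⊕ Fin n → ℕ × Fin n
  | Sum.inl i => (0, i)
  | Sum.inr i => (1, i)

/-- `S_∞`: top-left `2n × 2n` submatrix of `(M_[∞])*`. -/
def Sinf {n : ℕ} (L C R : Fin n → Fin n → EReal) :
    Fin n ⊕ Fin n → Fin n ⊕ Fin n → EReal :=
  fun p q => mpStar (Minf L C R) (embInf p) (embInf q)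

/-- A finite (or `⊥`) summand distributes over a supremum bound. -/
theorem iSup_add_le_of_forall {ι : Sort*} {a : ι → EReal} {x y : EReal} (hx : x ≠ ⊤)
    (h : ∀ k, a k + x ≤ y) : (⨆ k, a k) + x ≤ y := by
  induction x with
  | bot => simp
  | top => exact absurd rfl hx
  | coe r =>
    rw [← EReal.le_sub_iff_add_le (by simp) (by simp)]
    exact iSup_le fun k => (EReal.le_sub_iff_add_le (by simp) (by simp)).2 (h k)

theorem add_iSup_le_of_forall {ι : Sort*} {a : ι → EReal} {x y : EReal} (hx : x ≠ ⊤)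
    (h : ∀ k, x + a k ≤ y) : x + (⨆ k, a k) ≤ y := by
  rw [add_comm]
  exact iSup_add_le_of_forall hx fun k => by rw [add_comm]; exact h k

theorem mpMulVec_le_iff {N P : Type*} {A : N → P → EReal} {x : P → EReal} {i : N} {y : EReal} :
    mpMulVec A x i ≤ y ↔ ∀ j, A i j + x j ≤ y := iSup_le_iff

theorem mpMulVec_mpId {N : Type*} [DecidableEq N] (x : N → EReal) : mpMulVec mpId x = x := by
  funext i
  refine le_antisymm (iSup_le fun j => ?_) (le_iSup_of_le i (by simp [mpId]))
  by_cases h : i = j <;> simp [mpId, h]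

section Star

variable {N : Type*} [DecidableEq N] {A : N → N → EReal}

theorem mpPow_add_le {x : N → EReal} (hx : ∀ i, x i ≠ ⊤) (h : ∀ i j, A i j + x j ≤ x i)
    (k : ℕ) (i j : N) : mpPow A k i j + x j ≤ x i := by
  induction k generalizing j with
  | zero => by_cases hij : i = j <;> simp [mpPow, mpId, hij]
  | succ k ih =>
    refine iSup_add_le_of_forall (hx j) fun l => ?_
    rw [add_assoc]
    exact (add_le_add_right (h l j) _).trans (ih l)

theorem add_mpPow_le (hA : ∀ i j, A i j ≠ ⊤) (k : ℕ) (i j l : N) :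
    A i j + mpPow A k j l ≤ mpPow A (k + 1) i l := by
  induction k generalizing l with
  | zero =>
    refine le_trans ?_ (le_iSup (fun m => mpPow A 0 i m + A m l) i)
    by_cases hjl : j = l <;> simp [mpPow, mpId, hjl]
  | succ k ih =>
    refine add_iSup_le_of_forall (hA i j) fun m => ?_
    rw [← add_assoc]
    exact (add_le_add_left (ih m) _).trans (le_iSup (fun m => mpPow A (k + 1) i m + A m l) m)

/-- The vectors without `⊤` entries in the image of `A*` are the solutions of `A ⊗ x ≤ x`. -/
theorem mem_mpIm_mpStar_iff (hA : ∀ i j, A i j ≠ ⊤) (x : N → EReal) :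
    x ∈ mpIm (mpStar A) ↔ (∀ i, x i ≠ ⊤) ∧ ∀ i j, A i j + x j ≤ x i := by
  constructor
  · rintro ⟨hx, u, hu, rfl⟩
    refine ⟨hx, fun i j => add_iSup_le_of_forall (hA i j) fun l => ?_⟩
    rw [← add_assoc]
    refine le_trans (add_le_add_left ?_ _) (le_iSup (fun l => mpStar A i l + u l) l)
    exact add_iSup_le_of_forall (hA i j) fun k =>
      (add_mpPow_le hA k i j l).trans (le_iSup (fun k => mpPow A k i l) (k + 1))
  · rintro ⟨hx, h⟩
    refine ⟨hx, x, hx, funext fun i => le_antisymm ?_ ?_⟩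
    · calc x i = mpPow A 0 i i + x i := by simp [mpPow, mpId]
        _ ≤ mpStar A i i + x i := add_le_add_left (le_iSup (fun k => mpPow A k i i) 0) _
        _ ≤ mpMulVec (mpStar A) x i := le_iSup (fun j => mpStar A i j + x j) i
    · exact iSup_le fun j => iSup_add_le_of_forall (hx j) fun k => mpPow_add_le hx h k i j

end Star

section Chain

variable {n : ℕ} {L C R : Fin n → Fin n → EReal}

/-- The stacked pair `(x, y)` satisfies `H ⊗ (x, y) ≤ (x, y)`. -/
def PairStable (L C R : Fin n → Fin n → EReal) (x y : Fin n → EReal) : Prop :=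
  ∀ p q, Hmat L C R p q + Sum.elim x y q ≤ Sum.elim x y p

theorem pairStable_iff {x y : Fin n → EReal} :
    PairStable L C R x y ↔ (∀ i j, C i j + x j ≤ x i) ∧ (∀ i j, L i j + y j ≤ x i) ∧
      (∀ i j, R i j + x j ≤ y i) ∧ ∀ i j, C i j + y j ≤ y i := by
  simp only [PairStable, Sum.forall, Hmat, Sum.elim_inl, Sum.elim_inr, forall_and]
  tauto

/-- Pairs that extend to a trajectory of `k + 2` vectors all of whose consecutive pairs are
stable. -/
def chainSet (L C R : Fin n → Fin n → EReal) (k : ℕ) : Set (Fin n ⊕ Fin n → EReal) :=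
  { x | ∃ z : ℕ → Fin n → EReal, (∀ t i, z t i ≠ ⊤) ∧ Sum.elim (z 0) (z 1) = x ∧
    ∀ t ≤ k, PairStable L C R (z t) (z (t + 1)) }

theorem Hmat_ne_top (hL : ∀ i j, L i j ≠ ⊤) (hC : ∀ i j, C i j ≠ ⊤) (hR : ∀ i j, R i j ≠ ⊤)
    (p q : Fin n ⊕ Fin n) : Hmat L C R p q ≠ ⊤ := by
  rcases p with i | i <;> rcases q with j | j <;> simp [Hmat, hL, hC, hR]

theorem Kset_eq_chainSet_zero (hL : ∀ i j, L i j ≠ ⊤) (hC : ∀ i j, C i j ≠ ⊤)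
    (hR : ∀ i j, R i j ≠ ⊤) : Kset L C R = chainSet L C R 0 := by
  ext x
  rw [Kset, mem_mpIm_mpStar_iff (Hmat_ne_top hL hC hR)]
  constructor
  · rintro ⟨hx, h⟩
    refine ⟨fun t => if t = 0 then x ∘ Sum.inl else x ∘ Sum.inr, fun t i => ?_, ?_, ?_⟩
    · dsimp only
      split_ifs <;> exact hx _
    · simp
    · intro t ht
      obtain rfl : t = 0 := by omega
      simpa [PairStable] using h
  · rintro ⟨z, hz, rfl, h⟩
    exact ⟨by simp [hz], h 0 le_rfl⟩

/-- The lifted dynamics shifts the pair and writes the control into the second block. -/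
theorem max_mpMulVec_Abar_Bbar (x : Fin n ⊕ Fin n → EReal) (u : Fin n → EReal) :
    (fun p => max (mpMulVec (Abar n) x p) (mpMulVec (Bbar n) u p)) =
      Sum.elim (x ∘ Sum.inr) u := by
  funext p
  rcases p with i | i
  · have h := congrFun (mpMulVec_mpId (x ∘ Sum.inr)) i
    simp only [mpMulVec, Function.comp_apply] at h
    simp [mpMulVec, Abar, Bbar, iSup_sum, h]
  · have h := congrFun (mpMulVec_mpId u) i
    simp only [mpMulVec] at h
    simp [mpMulVec, Abar, Bbar, h]

theorem mpPhi_chainSet (k : ℕ) :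
    mpPhi (Abar n) (Bbar n) (chainSet L C R k) = chainSet L C R (k + 1) := by
  ext x
  simp only [mpPhi, Set.mem_inter_iff, Set.mem_ofPred_eq, max_mpMulVec_Abar_Bbar]
  constructor
  · rintro ⟨⟨z, hz, rfl, hzs⟩, -, u, -, w, hw, hwu, hws⟩
    have hw0 : w 0 = z 1 := funext fun i => congrFun hwu (Sum.inl i)
    refine ⟨fun t => t.casesOn (z 0) w, ?_, by simp [hw0], ?_⟩
    · rintro (_ | t) i
      exacts [hz 0 i, hw t i]
    · rintro (_ | t) ht
      · simpa [hw0] using hzs 0 (Nat.zero_le k)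
      · exact hws t (by omega)
  · rintro ⟨z, hz, rfl, hzs⟩
    refine ⟨⟨z, hz, rfl, fun t ht => hzs t (by omega)⟩, by simp [hz], z 2, hz 2,
      fun t => z (t + 1), fun t => hz (t + 1), rfl, fun t ht => hzs (t + 1) (by omega)⟩

theorem mpMulVec_MK_le_iff (k : ℕ) (z : ℕ → Fin n → EReal) :
    (∀ p, mpMulVec (MK L C R (k + 2)) (fun q => z q.1 q.2) p ≤ z p.1 p.2) ↔
      ∀ t ≤ k, PairStable L C R (z t) (z (t + 1)) := by
  simp only [mpMulVec_le_iff, pairStable_iff]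
  constructor
  · intro h t ht
    have key (a b : ℕ) (ha : a < k + 2) (hb : b < k + 2) (i j : Fin n) :
        MK L C R (k + 2) (⟨a, ha⟩, i) (⟨b, hb⟩, j) + z b j ≤ z a i :=
      h (⟨a, ha⟩, i) (⟨b, hb⟩, j)
    refine ⟨fun i j => ?_, fun i j => ?_, fun i j => ?_, fun i j => ?_⟩
    · simpa [MK] using key t t (by omega) (by omega) i j
    · simpa [MK] using key t (t + 1) (by omega) (by omega) i j
    · simpa [MK, show t + 1 + 1 ≠ t by omega] using key (t + 1) t (by omega) (by omega) i j
    · simpa [MK] using key (t + 1) (t + 1) (by omega) (by omega) i j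
  · rintro h ⟨⟨a, ha⟩, i⟩ ⟨⟨b, hb⟩, j⟩
    simp only [MK]
    split_ifs with h₁ h₂ h₃
    · subst h₁
      rcases Nat.lt_or_ge k a with hka | hka
      · obtain rfl : a = k + 1 := by omega
        exact (h k le_rfl).2.2.2 i j
      · exact (h a hka).1 i j
    · subst h₂
      exact (h a (by omega)).2.1 i j
    · subst h₃
      exact (h b (by omega)).2.2.1 i j
    · simp

end Chain

/-- `φ^k(K)` equals the set of pairs `(x₁, x₂) ∈ ℝ_max^{2n}`
admitting `x₃, …, x_{k+2} ∈ ℝ_max^n` such that the stacked vector satisfies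
`x_[k+2] ≥ M_[k+2] ⊗ x_[k+2]`. -/
theorem stmt_12 (n : ℕ) (hn : 0 < n) (L C R : Fin n → Fin n → EReal)
    (hL : ∀ i j, L i j ≠ ⊤) (hC : ∀ i j, C i j ≠ ⊤) (hR : ∀ i j, R i j ≠ ⊤)
    (k : ℕ) :
    (mpPhi (Abar n) (Bbar n))^[k] (Kset L C R) =
      { xbar : Fin n ⊕ Fin n → EReal |
        (∀ p, xbar p ≠ ⊤) ∧
        ∃ y : Fin (k + 2) × Fin n → EReal,
          (∀ p, y p ≠ ⊤) ∧
          (∀ i : Fin n, y ((⟨0, by omega⟩ : Fin (k + 2)), i) = xbar (Sum.inl i)) ∧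
          (∀ i : Fin n, y ((⟨1, by omega⟩ : Fin (k + 2)), i) = xbar (Sum.inr i)) ∧
          (∀ p, mpMulVec (MK L C R (k + 2)) y p ≤ y p) } := by
  have hiter : (mpPhi (Abar n) (Bbar n))^[k] (Kset L C R) = chainSet L C R k := by
    induction k with
    | zero => exact Kset_eq_chainSet_zero hL hC hR
    | succ k ih => rw [Function.iterate_succ_apply', ih, mpPhi_chainSet]
  rw [hiter]
  ext x
  constructor
  · rintro ⟨z, hz, rfl, hzs⟩
    exact ⟨by simp [hz], fun q => z q.1 q.2, fun p => hz _ _, fun i => rfl, fun i => rfl,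
      (mpMulVec_MK_le_iff k z).2 hzs⟩
  · rintro ⟨-, y, hy, hy0, hy1, h⟩
    let z : ℕ → Fin n → EReal := fun t i => if ht : t < k + 2 then y (⟨t, ht⟩, i) else ⊥
    have hzy : (fun q : Fin (k + 2) × Fin n => z q.1 q.2) = y := by
      funext q
      simp [z]
    refine ⟨z, fun t i => ?_, ?_, (mpMulVec_MK_le_iff k z).1 fun p => ?_⟩
    · by_cases ht : t < k + 2 <;> simp [z, ht, hy]
    · funext p
      rcases p with i | i
      · exact (congrFun hzy (⟨0, by omega⟩, i)).trans (hy0 i)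
      · exact (congrFun hzy (⟨1, by omega⟩, i)).trans (hy1 i)
    · rw [hzy]
      exact (h p).trans_eq (congrFun hzy p).symm
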